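/- arXiv:2412.18646 — 2 statements merged into one kernel-verified Lean document; each statement's English description precedes it below -/
import Mathlib

section
/- Let k ≥ 1, let d be a density matrix on ℂ^{2^k}, and let ρ = (ρ_z)_{z≥1} be a state such that ρ_{nk} equals the n-fold Kronecker power d^{⊗n} for every n ≥ 1. Let s ∈ [0,1] satisfy s < liminf_{z→∞} H(ρ_z)/z. Then ρ is not covered by any quantum s-test: for every sequence (T^m)_{m≥1} of Hermitian projections, with T^m on ℂ^{2^{u_m}}, such that ∑_{m≥1} 2^{-s·u_m}·Tr(T^m) < ∞, and for every δ > 0, there are only finitely many m with Tr(ρ_{u_m}·T^m) > δ. -/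
open Matrix Filter MeasureTheory
open scoped ComplexOrder

/-- Von Neumann entropy of a Hermitian matrix: the Shannon entropy (base 2) of its
eigenvalue distribution, with the convention `0 * log₂ 0 = 0` (automatic since
`Real.logb 2 0 = 0`). -/
noncomputable def vnEntropy {ι : Type} [Fintype ι] [DecidableEq ι]
    {A : Matrix ι ι ℂ} (hA : A.IsHermitian) : ℝ :=
  -∑ i, hA.eigenvalues i * Real.logb 2 (hA.eigenvalues i)

/-- A state: a sequence `ρ n` of density matrices on `ℂ^(2^n)` (rows and columns indexed by
length-`n` bitstrings) satisfying the partial-trace coherence condition. -/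
structure QState where
  M : (n : ℕ) → Matrix (Fin n → Bool) (Fin n → Bool) ℂ
  posSemidef : ∀ n, (M n).PosSemidef
  trace_one : ∀ n, (M n).trace = 1
  coherent : ∀ n (σ σ' : Fin n → Bool),
    M n σ σ' = M (n + 1) (Fin.snoc σ false) (Fin.snoc σ' false)
             + M (n + 1) (Fin.snoc σ true) (Fin.snoc σ' true)

/-- The von Neumann entropy of the length-`n` initial segment of a state. -/
noncomputable def QState.entropy (ρ : QState) (n : ℕ) : ℝ :=
  vnEntropy (ρ.posSemidef n).1

/-- The index of the `i`-th position of the `j`-th block of length `k` inside `Fin (n * k)`;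
used to express the `n`-fold Kronecker power of a matrix indexed by length-`k` bitstrings. -/
def blockIdx {n k : ℕ} (j : Fin n) (i : Fin k) : Fin (n * k) :=
  ⟨(j : ℕ) * k + (i : ℕ), by
    calc (j : ℕ) * k + (i : ℕ) < (j : ℕ) * k + k := Nat.add_lt_add_left i.isLt _
      _ = ((j : ℕ) + 1) * k := by ring
      _ ≤ n * k := Nat.mul_le_mul_right k j.isLt⟩

/-- The `n`-fold Kronecker power of a square matrix, indexed by tuples. -/
def kronPow {ι : Type} (n : ℕ) (A : Matrix ι ι ℂ) : Matrix (Fin n → ι) (Fin n → ι) ℂ :=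
  Matrix.of fun σ σ' => ∏ j, A (σ j) (σ' j)

lemma kronPow_mul {ι : Type} [Fintype ι] [DecidableEq ι] (n : ℕ) (A B : Matrix ι ι ℂ) :
    kronPow n (A * B) = kronPow n A * kronPow n B := by
  ext σ σ'
  simp only [kronPow, Matrix.of_apply, Matrix.mul_apply, Fintype.prod_sum, Finset.prod_mul_distrib]

lemma kronPow_diagonal {ι : Type} [DecidableEq ι] (n : ℕ) (v : ι → ℂ) :
    kronPow n (diagonal v) = diagonal fun σ : Fin n → ι => ∏ j, v (σ j) := by
  ext σ σ'
  simp only [kronPow, Matrix.of_apply, diagonal_apply]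
  split_ifs with h
  · subst h; simp
  · obtain ⟨j, hj⟩ := Function.ne_iff.1 h
    exact Finset.prod_eq_zero (Finset.mem_univ j) (by simp [hj])

lemma charpoly_kronPow {ι : Type} [Fintype ι] [DecidableEq ι] (n : ℕ) {A : Matrix ι ι ℂ}
    (hA : A.IsHermitian) :
    (kronPow n A).charpoly =
      ∏ σ : Fin n → ι, (Polynomial.X - Polynomial.C ((∏ j, hA.eigenvalues (σ j) : ℝ) : ℂ)) := by
  have hU : star (hA.eigenvectorUnitary : Matrix ι ι ℂ) * hA.eigenvectorUnitary = 1 :=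
    Unitary.coe_star_mul_self _
  conv_lhs => rw [hA.spectral_theorem, Unitary.conjStarAlgAut_apply]
  rw [kronPow_mul, charpoly_mul_comm, ← kronPow_mul, ← mul_assoc, hU, one_mul, kronPow_diagonal,
    charpoly_diagonal]
  simp

/-- Sums over the eigenvalues of a Hermitian matrix can be computed from any real factorization
of its characteristic polynomial. -/
lemma sum_eigenvalues_eq_of_charpoly_eq {ι κ : Type} [Fintype ι] [DecidableEq ι] [Fintype κ]
    {A : Matrix ι ι ℂ} (hA : A.IsHermitian) (v : κ → ℝ)
    (h : A.charpoly = ∏ i, (Polynomial.X - Polynomial.C (v i : ℂ))) (g : ℝ → ℝ) :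
    ∑ i, g (hA.eigenvalues i) = ∑ i, g (v i) := by
  have h1 := hA.roots_charpoly_eq_eigenvalues
  rw [h, Polynomial.roots_prod _ _ (by
    simp [Finset.prod_ne_zero_iff, Polynomial.X_sub_C_ne_zero])] at h1
  have h2 := congrArg (fun s : Multiset ℂ => (s.map fun z => g z.re).sum) h1
  simpa [Multiset.bind_singleton, Multiset.map_map] using h2.symm

/-- The power sum `∑ i, p i ^ (1 + x)` has derivative `∑ i, p i * log (p i)` at `x = 0`. -/
lemma hasDerivAt_sum_rpow {ι : Type} [Fintype ι] (p : ι → ℝ) (hp : ∀ i, 0 ≤ p i) :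
    HasDerivAt (fun x : ℝ => ∑ i, p i ^ (1 + x)) (∑ i, p i * Real.log (p i)) 0 := by
  refine HasDerivAt.fun_sum fun i _ => ?_
  rcases (hp i).eq_or_lt with h | h
  · rw [← h, zero_mul]
    refine (hasDerivAt_const (0 : ℝ) (0 : ℝ)).congr_of_eventuallyEq ?_
    filter_upwards [lt_mem_nhds (show (-1 : ℝ) < 0 by norm_num)] with x hx
    exact Real.zero_rpow (by linarith)
  · have := (((hasDerivAt_id (0 : ℝ)).const_add 1).const_rpow h)
    simpa [mul_comm] using this

lemma vnEntropy_mul_log_two {ι : Type} [Fintype ι] [DecidableEq ι]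
    {A : Matrix ι ι ℂ} (hA : A.IsHermitian) :
    vnEntropy hA * Real.log 2 = -∑ i, hA.eigenvalues i * Real.log (hA.eigenvalues i) := by
  have h2 : Real.log 2 ≠ 0 := (Real.log_pos (by norm_num)).ne'
  simp only [vnEntropy, Real.logb, neg_mul, Finset.sum_mul]
  congr 1
  exact Finset.sum_congr rfl fun i _ => by field_simp

lemma Matrix.PosSemidef.sum_eigenvalues_eq_one {ι : Type} [Fintype ι] [DecidableEq ι]
    {A : Matrix ι ι ℂ} (hA : A.PosSemidef) (htr : A.trace = 1) :
    ∑ i, hA.1.eigenvalues i = 1 := by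
  have := hA.1.trace_eq_sum_eigenvalues
  rw [htr] at this
  have h := congrArg Complex.re this
  simpa using h.symm

/-- In an eigenbasis of `A`, the diagonal of a Hermitian projection `T` is a vector of weights
in `[0, 1]`. -/
lemma exists_weights {ι : Type} [Fintype ι] [DecidableEq ι]
    {A T : Matrix ι ι ℂ} (hA : A.IsHermitian) (hT : T.IsHermitian) (hTT : T * T = T) :
    ∃ t : ι → ℝ, (∀ i, 0 ≤ t i) ∧ (∀ i, t i ≤ 1) ∧ ∑ i, t i = T.trace.re ∧
      (A * T).trace.re = ∑ i, hA.eigenvalues i * t i := by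
  set U : Matrix ι ι ℂ := hA.eigenvectorUnitary.1
  have hU : star U * U = 1 := Unitary.coe_star_mul_self _
  have hU' : U * star U = 1 := Unitary.coe_mul_star_self _
  have hspec : A = U * diagonal (RCLike.ofReal ∘ hA.eigenvalues) * star U := by
    conv_lhs => rw [hA.spectral_theorem, Unitary.conjStarAlgAut_apply]
  set S : Matrix ι ι ℂ := star U * T * U with hS
  have hSh : S.IsHermitian := by
    rw [hS, star_eq_conjTranspose]
    exact isHermitian_conjTranspose_mul_mul U hT
  have hSS : S * S = S := by
    calc S * S = star U * T * (U * star U) * T * U := by simp only [hS, mul_assoc]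
      _ = star U * (T * T) * U := by rw [hU']; simp only [mul_assoc, mul_one]
      _ = S := by rw [hTT]
  have hdiag : ∀ i, (S i i).re = ∑ j, Complex.normSq (S i j) := by
    intro i
    conv_lhs => rw [← hSS, mul_apply, Complex.re_sum]
    refine Finset.sum_congr rfl fun j _ => ?_
    rw [← hSh.apply j i, ← starRingEnd_apply, Complex.mul_conj, Complex.ofReal_re]
  have hsq : ∀ i, (S i i).re ^ 2 ≤ (S i i).re := by
    intro i
    calc (S i i).re ^ 2 ≤ Complex.normSq (S i i) := by
          rw [Complex.normSq_apply]; nlinarith [mul_self_nonneg (S i i).im]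
      _ ≤ ∑ j, Complex.normSq (S i j) :=
          Finset.single_le_sum (f := fun j => Complex.normSq (S i j))
            (fun j _ => Complex.normSq_nonneg _) (Finset.mem_univ i)
      _ = (S i i).re := (hdiag i).symm
  refine ⟨fun i => (S i i).re, fun i => ?_, fun i => ?_, ?_, ?_⟩
  · exact (Finset.sum_nonneg fun j _ => Complex.normSq_nonneg _).trans_eq (hdiag i).symm
  · nlinarith [hsq i]
  · have : S.trace = T.trace := by rw [hS, trace_mul_comm, ← mul_assoc, hU', one_mul]
    rw [← this, Matrix.trace, Complex.re_sum]
    rfl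
  · have : (A * T).trace = (diagonal (RCLike.ofReal ∘ hA.eigenvalues) * S).trace := by
      conv_lhs => rw [hspec]
      rw [mul_assoc, mul_assoc, trace_mul_comm]
      simp only [hS, mul_assoc]
    rw [this, Matrix.trace, Complex.re_sum]
    refine Finset.sum_congr rfl fun i _ => ?_
    simp [diagonal_mul]

lemma re_trace_mul_le_re_trace {ι : Type} [Fintype ι] [DecidableEq ι]
    {A T : Matrix ι ι ℂ} (hA : A.PosSemidef) (htr : A.trace = 1)
    (hT : T.IsHermitian) (hTT : T * T = T) : (A * T).trace.re ≤ T.trace.re := by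
  obtain ⟨t, h0, -, hsum, htrace⟩ := exists_weights hA.1 hT hTT
  rw [← hsum, htrace]
  refine Finset.sum_le_sum fun i _ => mul_le_of_le_one_left (h0 i) ?_
  rw [← hA.sum_eigenvalues_eq_one htr]
  exact Finset.single_le_sum (fun j _ => hA.eigenvalues_nonneg j) (Finset.mem_univ i)

/-- A Chernoff-type bound: eigenvalues above the threshold `θ` are controlled by the power sum,
the others by the rank of the projection. -/
lemma re_trace_mul_le_rpow_sum_add {ι : Type} [Fintype ι] [DecidableEq ι]
    {A T : Matrix ι ι ℂ} (hA : A.PosSemidef) (hT : T.IsHermitian) (hTT : T * T = T)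
    {x θ : ℝ} (hx : 0 < x) (hθ : 0 < θ) :
    (A * T).trace.re ≤ (∑ i, hA.1.eigenvalues i ^ (1 + x)) * θ ^ (-x) + θ * T.trace.re := by
  obtain ⟨t, h0, h1, hsum, htrace⟩ := exists_weights hA.1 hT hTT
  rw [← hsum, htrace, Finset.sum_mul, Finset.mul_sum, ← Finset.sum_add_distrib]
  refine Finset.sum_le_sum fun i _ => ?_
  have hp := hA.eigenvalues_nonneg i
  set p := hA.1.eigenvalues i
  have hpow : 0 ≤ p ^ (1 + x) * θ ^ (-x) := by positivity
  rcases le_total p θ with h | h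
  · have := mul_le_mul_of_nonneg_right h (h0 i)
    linarith
  · have hp' : 0 < p := hθ.trans_le h
    have hle : p ≤ p ^ (1 + x) * θ ^ (-x) := by
      rw [Real.rpow_add hp', Real.rpow_one, Real.rpow_neg hθ.le, mul_assoc, ← div_eq_mul_inv]
      refine le_mul_of_one_le_right hp ?_
      rw [one_le_div (by positivity)]
      exact Real.rpow_le_rpow hθ.le h hx.le
    have h2 : p * t i ≤ p := mul_le_of_le_one_right hp (h1 i)
    have h3 : 0 ≤ θ * t i := mul_nonneg hθ.le (h0 i)
    linarith

/-- Extending a projection by the identity on one more qubit. -/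
lemma QState.exists_extend_succ (ρ : QState) {u : ℕ}
    {T : Matrix (Fin u → Bool) (Fin u → Bool) ℂ} (hT : T.IsHermitian) (hTT : T * T = T) :
    ∃ T' : Matrix (Fin (u + 1) → Bool) (Fin (u + 1) → Bool) ℂ, T'.IsHermitian ∧ T' * T' = T' ∧
      T'.trace = 2 * T.trace ∧ (ρ.M (u + 1) * T').trace = (ρ.M u * T).trace := by
  let e := Fin.snocEquiv (fun _ : Fin (u + 1) => Bool)
  let K : Matrix (Bool × (Fin u → Bool)) (Bool × (Fin u → Bool)) ℂ :=
    kroneckerMap (· * ·) (1 : Matrix Bool Bool ℂ) T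
  have hK : ∀ a b σ σ', K (a, σ) (b, σ') = (if a = b then T σ σ' else 0) := by
    intro a b σ σ'
    simp [K, Matrix.one_apply]
  have hsum : ∀ f : (Fin (u + 1) → Bool) → ℂ, ∑ τ, f τ = ∑ b : Bool, ∑ σ, f (e (b, σ)) := by
    intro f
    rw [← e.sum_comp, Fintype.sum_prod_type]
  refine ⟨K.submatrix e.symm e.symm, ?_, ?_, ?_, ?_⟩
  · refine IsHermitian.submatrix ?_ _
    ext ⟨a, σ⟩ ⟨b, σ'⟩
    rw [conjTranspose_apply, hK, hK]
    by_cases h : a = b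
    · subst h; simpa using hT.apply σ σ'
    · simp [h, Ne.symm h]
  · rw [submatrix_mul_equiv, ← mul_kronecker_mul, one_mul, hTT]
  · simp [Matrix.trace, hsum, hK, two_mul]
  · simp only [Matrix.trace, diag_apply, mul_apply, hsum, submatrix_apply, Equiv.symm_apply_apply,
      hK, ρ.coherent u]
    simp [e, Fin.snocEquiv, Finset.sum_add_distrib, add_mul, add_comm]

lemma QState.exists_extend (ρ : QState) {u : ℕ}
    {T : Matrix (Fin u → Bool) (Fin u → Bool) ℂ} (hT : T.IsHermitian) (hTT : T * T = T)
    (r v : ℕ) (hv : v = u + r) :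
    ∃ T' : Matrix (Fin v → Bool) (Fin v → Bool) ℂ, T'.IsHermitian ∧ T' * T' = T' ∧
      T'.trace = 2 ^ r * T.trace ∧ (ρ.M v * T').trace = (ρ.M u * T).trace := by
  induction r generalizing v with
  | zero => subst hv; exact ⟨T, hT, hTT, by simp, rfl⟩
  | succ r ih =>
    subst hv
    obtain ⟨T₁, h₁, h₂, h₃, h₄⟩ := ih _ rfl
    obtain ⟨T₂, k₁, k₂, k₃, k₄⟩ := ρ.exists_extend_succ h₁ h₂
    exact ⟨T₂, k₁, k₂, by rw [k₃, h₃]; ring, k₄.trans h₄⟩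

/-- Power sums of the spectrum of a tensor power are powers of the power sum of the factor. -/
lemma QState.sum_eigenvalues_rpow (ρ : QState) {k n : ℕ}
    {d : Matrix (Fin k → Bool) (Fin k → Bool) ℂ} (hd : d.PosSemidef)
    (h : ∀ σ σ' : Fin (n * k) → Bool, ρ.M (n * k) σ σ' =
      ∏ j : Fin n, d (fun i => σ (blockIdx j i)) (fun i => σ' (blockIdx j i))) (x : ℝ) :
    ∑ i, (ρ.posSemidef (n * k)).1.eigenvalues i ^ (1 + x) =
      (∑ i, hd.1.eigenvalues i ^ (1 + x)) ^ n := by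
  let e : (Fin (n * k) → Bool) ≃ (Fin n → Fin k → Bool) :=
    (finProdFinEquiv.arrowCongr (Equiv.refl Bool)).symm.trans (Equiv.curry _ _ _)
  have he : ∀ σ j, e σ j = fun i => σ (blockIdx j i) := by
    intro σ j
    funext i
    simp only [e, Equiv.trans_apply, Equiv.curry_apply, Function.curry, Equiv.arrowCongr_symm,
      Equiv.arrowCongr_apply, Function.comp, Equiv.symm_symm, Equiv.refl_symm, Equiv.refl_apply]
    congr 1
    ext
    simp [blockIdx, finProdFinEquiv]
    ring
  have hM : ρ.M (n * k) = reindex e.symm e.symm (kronPow n d) := by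
    ext σ σ'
    simp [h, kronPow, he]
  have hchar := charpoly_kronPow n hd.1
  rw [← charpoly_reindex e.symm, ← hM] at hchar
  rw [sum_eigenvalues_eq_of_charpoly_eq (ρ.posSemidef (n * k)).1 _ hchar fun y => y ^ (1 + x),
    ← Fin.prod_const, Fintype.prod_sum]
  exact Finset.sum_congr rfl fun σ _ =>
    (Real.finsetProd_rpow _ _ (fun j _ => hd.eigenvalues_nonneg _) _).symm

lemma QState.entropy_tensor_power (ρ : QState) {k n : ℕ}
    {d : Matrix (Fin k → Bool) (Fin k → Bool) ℂ} (hd : d.PosSemidef) (hdtr : d.trace = 1)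
    (h : ∀ σ σ' : Fin (n * k) → Bool, ρ.M (n * k) σ σ' =
      ∏ j : Fin n, d (fun i => σ (blockIdx j i)) (fun i => σ' (blockIdx j i))) :
    ρ.entropy (n * k) = n * vnEntropy hd.1 := by
  have h1 := hasDerivAt_sum_rpow _ (ρ.posSemidef (n * k)).eigenvalues_nonneg
  simp only [ρ.sum_eigenvalues_rpow hd h] at h1
  have h2 := (hasDerivAt_sum_rpow _ hd.eigenvalues_nonneg).fun_pow n
  have h3 := h1.unique h2
  simp only [add_zero, Real.rpow_one, hd.sum_eigenvalues_eq_one hdtr, one_pow, mul_one] at h3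
  have h4 := vnEntropy_mul_log_two (ρ.posSemidef (n * k)).1
  rw [h3, ← mul_neg, ← vnEntropy_mul_log_two hd.1, ← mul_assoc] at h4
  exact mul_right_cancel₀ (Real.log_pos (by norm_num : (1 : ℝ) < 2)).ne' h4

/-- Below the entropy, the power sum decays faster than exponentially at rate `c`. -/
lemma exists_rpow_sum_mul_lt_one {ι : Type} [Fintype ι] [DecidableEq ι]
    {A : Matrix ι ι ℂ} (hA : A.PosSemidef) (htr : A.trace = 1) {c : ℝ}
    (hc : c < vnEntropy hA.1) :
    ∃ x > 0, (∑ i, hA.1.eigenvalues i ^ (1 + x)) * (2 : ℝ) ^ (c * x) < 1 := by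
  have h1 := hasDerivAt_sum_rpow _ hA.eigenvalues_nonneg
  have h2 : HasDerivAt (fun x : ℝ => (2 : ℝ) ^ (c * x)) (Real.log 2 * c) 0 := by
    simpa using ((hasDerivAt_id (0 : ℝ)).const_mul c).const_rpow (by norm_num : (0 : ℝ) < 2)
  have h3 := h1.fun_mul h2
  have hneg : (∑ i, hA.1.eigenvalues i * Real.log (hA.1.eigenvalues i)) * (2 : ℝ) ^ (c * 0) +
      (∑ i, hA.1.eigenvalues i ^ (1 + (0 : ℝ))) * (Real.log 2 * c) < 0 := by
    simp only [mul_zero, Real.rpow_zero, mul_one, add_zero, Real.rpow_one,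
      hA.sum_eigenvalues_eq_one htr, one_mul]
    have h4 := vnEntropy_mul_log_two hA.1
    nlinarith [Real.log_pos (by norm_num : (1 : ℝ) < 2)]
  have h5 := h3.tendsto_slope.mono_left (nhdsGT_le_nhdsNE (0 : ℝ))
  obtain ⟨x, hx, hx0⟩ :=
    ((h5.eventually_lt_const hneg).and (self_mem_nhdsWithin (s := Set.Ioi (0 : ℝ)))).exists
  have hx0' : 0 < x := hx0
  refine ⟨x, hx0', ?_⟩
  rw [slope_def_field, div_lt_iff₀ (by simpa using hx0'), zero_mul, sub_neg] at hx
  simpa [hA.sum_eigenvalues_eq_one htr] using hx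

/-- Let `d` be a density matrix on `ℂ^(2^k)` (`k ≥ 1`) and `ρ` a state
with `ρ_(nk) = d^{⊗n}` for every `n ≥ 1`, and let `s ∈ [0,1]` be below the entropy rate
`liminf_z H(ρ_z)/z`.  Then `ρ` is not covered by any quantum s-test: for every sequence
of Hermitian projections `T^m` on `ℂ^(2^(u_m))` with `∑_m 2^(-s·u_m)·Tr(T^m) < ∞` and
every `δ > 0`, only finitely many `m` satisfy `Tr(ρ_(u_m)·T^m) > δ`. -/
theorem tensor_power_not_covered_by_s_test (k : ℕ) (hk : 1 ≤ k)
    (d : Matrix (Fin k → Bool) (Fin k → Bool) ℂ)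
    (hd : d.PosSemidef) (hdtr : d.trace = 1)
    (ρ : QState)
    (htens : ∀ n : ℕ, 1 ≤ n → ∀ σ σ' : Fin (n * k) → Bool,
      ρ.M (n * k) σ σ' =
        ∏ j : Fin n, d (fun i => σ (blockIdx j i)) (fun i => σ' (blockIdx j i)))
    (s : ℝ) (hs0 : 0 ≤ s) (hs1 : s ≤ 1)
    (hs : s < Filter.liminf (fun z : ℕ => ρ.entropy z / z) Filter.atTop) :
    ∀ (u : ℕ → ℕ) (T : (m : ℕ) → Matrix (Fin (u m) → Bool) (Fin (u m) → Bool) ℂ),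
      (∀ m, (T m).IsHermitian ∧ T m * T m = T m) →
      Summable (fun m => (2 : ℝ) ^ (-(s * (u m : ℝ))) * ((T m).trace).re) →
      ∀ δ > (0 : ℝ), {m : ℕ | δ < ((ρ.M (u m) * T m).trace).re}.Finite := by
  have hk0 : (0 : ℝ) < k := by exact_mod_cast hk
  have hH : s * k < vnEntropy hd.1 := by
    have hne : {a : ℝ | ∀ᶠ z in atTop, a ≤ ρ.entropy z / (z : ℝ)}.Nonempty := by
      by_contra h
      rw [Filter.liminf_eq, Set.not_nonempty_iff_eq_empty.1 h, Real.sSup_empty] at hs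
      exact hs.not_ge hs0
    rw [Filter.liminf_eq] at hs
    obtain ⟨a, ha, hsa⟩ := exists_lt_of_lt_csSup hne hs
    obtain ⟨N, hN⟩ := eventually_atTop.1 ha
    have h1 := hN ((N + 1) * k) (by nlinarith)
    rw [ρ.entropy_tensor_power hd hdtr (htens (N + 1) (by omega))] at h1
    have hN0 : (0 : ℝ) < ((N + 1 : ℕ) : ℝ) := by positivity
    rw [Nat.cast_mul, mul_div_mul_left _ _ hN0.ne', le_div_iff₀ hk0] at h1
    exact (mul_lt_mul_of_pos_right hsa hk0).trans_le h1
  obtain ⟨x, hx, hq⟩ := exists_rpow_sum_mul_lt_one hd hdtr hH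
  set q : ℝ := (∑ i, hd.1.eigenvalues i ^ (1 + x)) * (2 : ℝ) ^ (s * k * x) with hqdef
  have hq0 : 0 ≤ q := mul_nonneg
    (Finset.sum_nonneg fun i _ => Real.rpow_nonneg (hd.eigenvalues_nonneg i) _) (by positivity)
  intro u T hT hsum δ hδ
  have hbound : ∀ m, ((ρ.M (u m) * T m).trace).re ≤
      q ^ (u m / k + 1) + 2 ^ k * ((2 : ℝ) ^ (-(s * (u m : ℝ))) * ((T m).trace).re) := by
    intro m
    set n := u m / k + 1 with hn
    have hmod : u m % k < k := Nat.mod_lt _ hk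
    have hv : n * k = u m + (k - u m % k) := by
      have := Nat.div_add_mod' (u m) k
      rw [hn, add_mul, one_mul]
      omega
    obtain ⟨T', h1, h2, h3, h4⟩ := ρ.exists_extend (hT m).1 (hT m).2 _ _ hv
    have htr0 : 0 ≤ (T m).trace.re := by
      obtain ⟨t, ht, -, hts, -⟩ := exists_weights (hT m).1 (hT m).1 (hT m).2
      rw [← hts]
      exact Finset.sum_nonneg fun i _ => ht i
    have h5 := re_trace_mul_le_rpow_sum_add (ρ.posSemidef (n * k)) h1 h2 hx
      (θ := (2 : ℝ) ^ (-(s * k * n))) (by positivity)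
    rw [h4, ρ.sum_eigenvalues_rpow hd (htens n (Nat.succ_pos _)), h3] at h5
    refine h5.trans (add_le_add (le_of_eq ?_) ?_)
    · rw [hqdef, mul_pow, ← Real.rpow_mul (by norm_num), ← Real.rpow_mul_natCast (by norm_num)]
      ring_nf
    · have h6 : ((2 : ℂ) ^ (k - u m % k) * (T m).trace).re =
          (2 : ℝ) ^ (k - u m % k) * (T m).trace.re := by
        rw [← Complex.re_ofReal_mul]; norm_num
      rw [h6, ← mul_assoc, ← mul_assoc, mul_comm ((2 : ℝ) ^ k)]
      refine mul_le_mul_of_nonneg_right (mul_le_mul ?_ ?_ (by positivity) (by positivity)) htr0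
      · refine Real.rpow_le_rpow_of_exponent_le (by norm_num) (neg_le_neg ?_)
        rw [mul_assoc]
        refine mul_le_mul_of_nonneg_left ?_ hs0
        have : u m ≤ k * n := by rw [mul_comm, hv]; omega
        exact_mod_cast this
      · exact pow_le_pow_right₀ (by norm_num) (Nat.sub_le _ _)
  obtain ⟨N, hN⟩ := exists_pow_lt_of_lt_one (half_pos hδ) hq
  set ε : ℝ := min (δ / 2 / 2 ^ k) ((2 : ℝ) ^ (-(s * (k * N : ℕ))) * δ) with hε
  have hε0 : 0 < ε := lt_min (by positivity) (by positivity)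
  have hfin := hsum.tendsto_cofinite_zero.eventually_lt_const hε0
  refine Set.Finite.subset (Filter.eventually_cofinite.1 hfin) fun m hm => ?_
  simp only [Set.mem_ofPred_eq] at hm ⊢
  rw [not_lt]
  by_cases hu : N ≤ u m / k
  · refine (min_le_left _ _).trans ?_
    have h1 : q ^ (u m / k + 1) ≤ q ^ N := pow_le_pow_of_le_one hq0 hq.le (by omega)
    rw [div_le_iff₀' (by positivity)]
    linarith [hbound m]
  · refine (min_le_right _ _).trans ?_
    have h1 := re_trace_mul_le_re_trace (ρ.posSemidef (u m)) (ρ.trace_one _) (hT m).1 (hT m).2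
    refine mul_le_mul ?_ (hm.le.trans h1) hδ.le (by positivity)
    refine Real.rpow_le_rpow_of_exponent_le (by norm_num) (neg_le_neg ?_)
    refine mul_le_mul_of_nonneg_left ?_ hs0
    have : u m ≤ k * N := by
      rw [mul_comm]
      exact ((Nat.div_lt_iff_lt_mul hk).1 (not_le.1 hu)).le
    exact_mod_cast this
end

section
/- Let f(x) = 1/(x·(1 - ln x)²) for x ∈ (0,1). Then ∫₀¹ f(x) dx = 1, and for α_σ := ∫_{[σ]} f(x) dx and H_n := -∑_{σ ∈ 2^n} α_σ·log₂(α_σ), one has lim_{n→∞} (H_n - n) = -∞; i.e., for every natural number c, H_n < n - c for all sufficiently large n. (Thus the induced diagonal state ρ_n = ∑_σ α_σ|σ⟩⟨σ| is strong quantum random yet fails the initial-segment entropy condition ∃c ∃^∞n H(ρ_n) > n - c.) -/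
open MeasureTheory

/-- The left endpoint of the dyadic interval `[σ]` determined by the bitstring `σ`. -/
noncomputable def dyadicLeft {n : ℕ} (σ : Fin n → Bool) : ℝ :=
  ∑ i : Fin n, if σ i then (2 : ℝ) ^ (-(i : ℤ) - 1) else 0

/-- The dyadic interval `[σ] ⊆ [0,1)` of length `2^(-n)`. -/
noncomputable def dyadicInterval {n : ℕ} (σ : Fin n → Bool) : Set ℝ :=
  Set.Ico (dyadicLeft σ) (dyadicLeft σ + (2 : ℝ) ^ (-(n : ℤ)))

lemma dyadicLeft_snoc {n : ℕ} (σ : Fin n → Bool) (b : Bool) :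
    dyadicLeft (Fin.snoc σ b : Fin (n + 1) → Bool) =
      dyadicLeft σ + if b then (2 : ℝ) ^ (-(n : ℤ) - 1) else 0 := by
  simp [dyadicLeft, Fin.sum_univ_castSucc]

lemma two_zpow_neg_eq_add (n : ℕ) :
    (2 : ℝ) ^ (-(n : ℤ)) = (2 : ℝ) ^ (-(n : ℤ) - 1) + (2 : ℝ) ^ (-(n : ℤ) - 1) := by
  rw [zpow_sub_one₀ two_ne_zero]
  ring

lemma two_zpow_neg_succ (n : ℕ) :
    (2 : ℝ) ^ (-((n + 1 : ℕ) : ℤ)) = (2 : ℝ) ^ (-(n : ℤ) - 1) := by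
  congr 1
  push_cast
  ring

lemma dyadicInterval_snoc_false {n : ℕ} (σ : Fin n → Bool) :
    dyadicInterval (Fin.snoc σ false : Fin (n + 1) → Bool) =
      Set.Ico (dyadicLeft σ) (dyadicLeft σ + (2 : ℝ) ^ (-(n : ℤ) - 1)) := by
  rw [dyadicInterval, dyadicLeft_snoc, two_zpow_neg_succ]
  simp

lemma dyadicInterval_snoc_true {n : ℕ} (σ : Fin n → Bool) :
    dyadicInterval (Fin.snoc σ true : Fin (n + 1) → Bool) =
      Set.Ico (dyadicLeft σ + (2 : ℝ) ^ (-(n : ℤ) - 1))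
        (dyadicLeft σ + (2 : ℝ) ^ (-(n : ℤ))) := by
  rw [dyadicInterval, dyadicLeft_snoc, two_zpow_neg_succ, two_zpow_neg_eq_add n]
  simp [add_assoc]

lemma dyadicInterval_eq_union {n : ℕ} (σ : Fin n → Bool) :
    dyadicInterval σ = dyadicInterval (Fin.snoc σ false : Fin (n + 1) → Bool) ∪
      dyadicInterval (Fin.snoc σ true : Fin (n + 1) → Bool) := by
  have h : (0 : ℝ) < (2 : ℝ) ^ (-(n : ℤ) - 1) := by positivity
  rw [dyadicInterval_snoc_false, dyadicInterval_snoc_true, dyadicInterval,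
    Set.Ico_union_Ico_eq_Ico (by linarith)]
  rw [two_zpow_neg_eq_add n]
  linarith

lemma disjoint_dyadicInterval_snoc {n : ℕ} (σ : Fin n → Bool) :
    Disjoint (dyadicInterval (Fin.snoc σ false : Fin (n + 1) → Bool))
      (dyadicInterval (Fin.snoc σ true : Fin (n + 1) → Bool)) := by
  rw [dyadicInterval_snoc_false, dyadicInterval_snoc_true, Set.disjoint_left]
  intro x hx hx'
  exact absurd hx.2 (not_lt.2 hx'.1)

lemma dyadicLeft_nonneg {n : ℕ} (σ : Fin n → Bool) : 0 ≤ dyadicLeft σ :=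
  Finset.sum_nonneg fun i _ => by split_ifs <;> positivity

lemma dyadicLeft_add_le_one {n : ℕ} (σ : Fin n → Bool) :
    dyadicLeft σ + (2 : ℝ) ^ (-(n : ℤ)) ≤ 1 := by
  induction n with
  | zero => simp [dyadicLeft]
  | succ n ih =>
    obtain ⟨⟨b, τ⟩, rfl⟩ := (Fin.snocEquiv fun _ => Bool).surjective σ
    have h := ih τ
    have hpos : (0 : ℝ) < (2 : ℝ) ^ (-(n : ℤ) - 1) := by positivity
    change dyadicLeft (Fin.snoc τ b : Fin (n + 1) → Bool) + _ ≤ 1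
    rw [dyadicLeft_snoc, two_zpow_neg_succ]
    rw [two_zpow_neg_eq_add n] at h
    split_ifs <;> linarith

lemma dyadicInterval_subset {n : ℕ} (σ : Fin n → Bool) :
    dyadicInterval σ ⊆ Set.Ico 0 1 :=
  Set.Ico_subset_Ico (dyadicLeft_nonneg σ) (dyadicLeft_add_le_one σ)

lemma measurableSet_dyadicInterval {n : ℕ} (σ : Fin n → Bool) :
    MeasurableSet (dyadicInterval σ) :=
  measurableSet_Ico

/-- The dyadic intervals of level `n` partition `[0,1)`. -/
lemma sum_setIntegral_dyadicInterval {g : ℝ → ℝ} (hg : IntegrableOn g (Set.Ico 0 1)) (n : ℕ) :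
    ∑ σ : Fin n → Bool, ∫ x in dyadicInterval σ, g x = ∫ x in Set.Ico (0 : ℝ) 1, g x := by
  induction n with
  | zero => simp [dyadicInterval, dyadicLeft]
  | succ n ih =>
    rw [← ih, ← Fintype.sum_equiv (Fin.snocEquiv fun _ : Fin (n + 1) => Bool)
      (fun p => ∫ x in dyadicInterval (Fin.snoc p.2 p.1 : Fin (n + 1) → Bool), g x) _
      fun _ => rfl, Fintype.sum_prod_type_right]
    refine Finset.sum_congr rfl fun σ _ => ?_
    rw [Fintype.sum_bool, dyadicInterval_eq_union σ,
      setIntegral_union (disjoint_dyadicInterval_snoc σ) (measurableSet_dyadicInterval _)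
        (hg.mono_set (dyadicInterval_subset _)) (hg.mono_set (dyadicInterval_subset _)), add_comm]

/-- The probability density `1 / (x (1 - ln x)²)` on `(0,1)`. -/
noncomputable def logSqDensity (x : ℝ) : ℝ := 1 / (x * (1 - Real.log x) ^ 2)

lemma one_le_one_sub_log {x : ℝ} (hx : x ∈ Set.Ico (0 : ℝ) 1) : 1 ≤ 1 - Real.log x := by
  have := Real.log_nonpos hx.1 hx.2.le
  linarith

lemma logSqDensity_nonneg {x : ℝ} (hx : 0 ≤ x) : 0 ≤ logSqDensity x := by
  unfold logSqDensity
  positivity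

lemma hasDerivAt_inv_one_sub_log {x : ℝ} (hx : x ∈ Set.Ioo (0 : ℝ) 1) :
    HasDerivAt (fun y => (1 - Real.log y)⁻¹) (logSqDensity x) x := by
  have h1 := one_le_one_sub_log ⟨hx.1.le, hx.2⟩
  have hx0 := hx.1.ne'
  have hu : 1 - Real.log x ≠ 0 := by positivity
  refine (((Real.hasDerivAt_log hx0).const_sub 1).inv hu).congr_deriv ?_
  unfold logSqDensity
  field_simp

lemma tendsto_inv_one_sub_log_nhdsGT_zero :
    Filter.Tendsto (fun y => (1 - Real.log y)⁻¹) (nhdsWithin 0 (Set.Ioi 0)) (nhds 0) := by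
  refine Filter.Tendsto.inv_tendsto_atTop ?_
  have := Filter.tendsto_neg_atBot_atTop.comp Real.tendsto_log_nhdsGT_zero
  simpa [sub_eq_add_neg, Function.comp_def] using Filter.tendsto_atTop_add_const_left _ 1 this

lemma continuousAt_inv_one_sub_log_one : ContinuousAt (fun y => (1 - Real.log y)⁻¹) 1 :=
  (continuousAt_const.sub (Real.continuousAt_log one_ne_zero)).inv₀ (by simp)

lemma integrableOn_logSqDensity_Ioc : IntegrableOn logSqDensity (Set.Ioc 0 1) := by
  have heq : ∀ x : ℝ, 0 < x →
      Function.update (fun y => (1 - Real.log y)⁻¹) 0 0 =ᶠ[nhds x]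
        fun y => (1 - Real.log y)⁻¹ := fun x hx => by
    filter_upwards [lt_mem_nhds hx] with y hy
    exact Function.update_of_ne hy.ne' _ _
  refine intervalIntegral.integrableOn_deriv_of_nonneg
    (g := Function.update (fun y => (1 - Real.log y)⁻¹) 0 0) (fun x hx => ?_) (fun x hx => ?_)
    fun x hx => logSqDensity_nonneg hx.1.le
  · rcases hx.1.eq_or_lt with rfl | h0
    · rw [continuousWithinAt_update_same]
      refine tendsto_inv_one_sub_log_nhdsGT_zero.mono_left (nhdsWithin_mono _ fun y hy => ?_)
      exact lt_of_le_of_ne hy.1.1 (Ne.symm hy.2)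
    · refine ContinuousAt.continuousWithinAt ((continuousAt_congr (heq x h0)).2 ?_)
      rcases hx.2.eq_or_lt with rfl | h1
      · exact continuousAt_inv_one_sub_log_one
      · exact (hasDerivAt_inv_one_sub_log ⟨h0, h1⟩).continuousAt
  · exact (hasDerivAt_inv_one_sub_log hx).congr_of_eventuallyEq (heq x hx.1)

lemma integrableOn_logSqDensity : IntegrableOn logSqDensity (Set.Ico 0 1) :=
  (integrableOn_Ico_iff_integrableOn_Ioo (by simp)).2
    (integrableOn_logSqDensity_Ioc.mono_set Set.Ioo_subset_Ioc_self)

lemma setIntegral_logSqDensity : ∫ x in Set.Ioo (0 : ℝ) 1, logSqDensity x = 1 := by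
  have h := intervalIntegral.integral_eq_sub_of_hasDerivAt_of_tendsto zero_lt_one
    (fun x hx => hasDerivAt_inv_one_sub_log hx)
    ((intervalIntegrable_iff_integrableOn_Ioc_of_le zero_le_one).2 integrableOn_logSqDensity_Ioc)
    tendsto_inv_one_sub_log_nhdsGT_zero
    (continuousAt_inv_one_sub_log_one.tendsto.mono_left nhdsWithin_le_nhds)
  rw [intervalIntegral.integral_of_le zero_le_one, integral_Ioc_eq_integral_Ioo] at h
  simpa using h

lemma setIntegral_Ico_logSqDensity : ∫ x in Set.Ico (0 : ℝ) 1, logSqDensity x = 1 := by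
  rw [integral_Ico_eq_integral_Ioo, setIntegral_logSqDensity]

lemma mul_one_sub_log_sq_le {x : ℝ} (hx : x ∈ Set.Ioo (0 : ℝ) 1) :
    x * (1 - Real.log x) ^ 2 ≤ 16 * √x := by
  set t := √(√x) with ht
  have ht0 : 0 < t := Real.sqrt_pos.2 (Real.sqrt_pos.2 hx.1)
  have ht2 : t ^ 2 = √x := Real.sq_sqrt (Real.sqrt_nonneg x)
  have htx : x = t ^ 4 := by
    rw [show t ^ 4 = (t ^ 2) ^ 2 by ring, ht2, Real.sq_sqrt hx.1.le]
  have hlog : Real.log x = 4 * Real.log t := by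
    rw [htx, Real.log_pow]
    norm_num
  have h1 := one_le_one_sub_log ⟨hx.1.le, hx.2⟩
  have h2 : 1 - Real.log x ≤ 4 * t⁻¹ := by
    have := Real.log_le_sub_one_of_pos (inv_pos.2 ht0)
    rw [Real.log_inv] at this
    linarith
  have h3 : (1 - Real.log x) ^ 2 ≤ (4 * t⁻¹) ^ 2 := by gcongr
  calc x * (1 - Real.log x) ^ 2 ≤ x * (4 * t⁻¹) ^ 2 := mul_le_mul_of_nonneg_left h3 hx.1.le
    _ = 16 * √x := by
      rw [← ht2]
      nth_rewrite 1 [htx]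
      field_simp
      ring

lemma inv_sqrt_le_logSqDensity {x : ℝ} (hx : x ∈ Set.Ioo (0 : ℝ) 1) :
    (16 * √x)⁻¹ ≤ logSqDensity x := by
  have h1 := one_le_one_sub_log ⟨hx.1.le, hx.2⟩
  have hx0 := hx.1
  rw [logSqDensity, one_div]
  exact inv_anti₀ (by positivity) (mul_one_sub_log_sq_le hx)

lemma le_setIntegral_dyadicInterval {n : ℕ} (σ : Fin n → Bool) :
    (2 : ℝ) ^ (-(n : ℤ)) * (16 * √(dyadicLeft σ + (2 : ℝ) ^ (-(n : ℤ))))⁻¹ ≤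
      ∫ x in dyadicInterval σ, logSqDensity x := by
  have hpos : (0 : ℝ) < (2 : ℝ) ^ (-(n : ℤ)) := by positivity
  have h0 := dyadicLeft_nonneg σ
  have h1 := dyadicLeft_add_le_one σ
  have hint : IntegrableOn logSqDensity
      (Set.Ioo (dyadicLeft σ) (dyadicLeft σ + (2 : ℝ) ^ (-(n : ℤ)))) :=
    integrableOn_logSqDensity.mono_set
      (Set.Ioo_subset_Ico_self.trans (dyadicInterval_subset σ))
  rw [dyadicInterval, integral_Ico_eq_integral_Ioo]
  refine le_trans (le_of_eq ?_) (setIntegral_ge_of_const_le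
    (c := (16 * √(dyadicLeft σ + (2 : ℝ) ^ (-(n : ℤ))))⁻¹) measurableSet_Ioo (by simp)
    (fun x hx => ?_) hint)
  · simp [Measure.real]
  · have hx0 : 0 < x := h0.trans_lt hx.1
    refine le_trans ?_ (inv_sqrt_le_logSqDensity ⟨hx0, hx.2.trans_le h1⟩)
    have := hx.2.le
    gcongr

lemma integrableOn_logSqDensity_mul_log_add {ε : ℝ} (hε : 0 < ε) :
    IntegrableOn (fun x => logSqDensity x * Real.log (x + ε)) (Set.Ico 0 1) := by
  refine Integrable.mul_bdd (c := max |Real.log ε| |Real.log (1 + ε)|) integrableOn_logSqDensity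
    (Real.measurable_log.comp (measurable_id.add_const ε)).aestronglyMeasurable ?_
  refine (ae_restrict_mem measurableSet_Ico).mono fun x hx => ?_
  have h1 : Real.log ε ≤ Real.log (x + ε) := Real.log_le_log hε (by linarith [hx.1])
  have h2 : Real.log (x + ε) ≤ Real.log (1 + ε) :=
    Real.log_le_log (by linarith [hx.1]) (by linarith [hx.2])
  exact abs_le_max_abs_abs h1 h2

lemma le_setIntegral_mul_log {n : ℕ} (σ : Fin n → Bool) :
    ∫ x in dyadicInterval σ, ((-(n * Real.log 2) - Real.log 16) * logSqDensity x -
        1 / 2 * (logSqDensity x * Real.log (x + (2 : ℝ) ^ (-(n : ℤ))))) ≤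
      (∫ x in dyadicInterval σ, logSqDensity x) *
        Real.log (∫ x in dyadicInterval σ, logSqDensity x) := by
  have hpos : (0 : ℝ) < (2 : ℝ) ^ (-(n : ℤ)) := by positivity
  have h0 := dyadicLeft_nonneg σ
  have hα := le_setIntegral_dyadicInterval σ
  have hr : 0 < dyadicLeft σ + (2 : ℝ) ^ (-(n : ℤ)) := by positivity
  have hsub := dyadicInterval_subset σ
  have hf := integrableOn_logSqDensity.mono_set hsub
  have hfl := (integrableOn_logSqDensity_mul_log_add hpos).mono_set hsub
  set r := dyadicLeft σ + (2 : ℝ) ^ (-(n : ℤ)) with hrdef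
  set α := ∫ x in dyadicInterval σ, logSqDensity x with hαdef
  have hlog : -(n * Real.log 2) - Real.log 16 - 1 / 2 * Real.log r ≤ Real.log α := by
    refine le_trans (le_of_eq ?_) (Real.log_le_log (by positivity) hα)
    rw [Real.log_mul (by positivity) (by positivity), Real.log_inv,
      Real.log_mul (by positivity) (by positivity), Real.log_zpow, Real.log_sqrt hr.le]
    push_cast
    ring
  have hα0 : 0 ≤ α := le_trans (by positivity) hα
  calc _ ≤ ∫ x in dyadicInterval σ,
        logSqDensity x * (-(n * Real.log 2) - Real.log 16 - 1 / 2 * Real.log r) := by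
        refine setIntegral_mono_on ((hf.const_mul _).sub (hfl.const_mul _)) (hf.mul_const _)
          (measurableSet_dyadicInterval σ) fun x hx => ?_
        have hx0 : dyadicLeft σ ≤ x := hx.1
        have hl : Real.log r ≤ Real.log (x + (2 : ℝ) ^ (-(n : ℤ))) :=
          Real.log_le_log hr (by rw [hrdef]; linarith)
        have := mul_le_mul_of_nonneg_left hl (logSqDensity_nonneg (h0.trans hx0))
        linarith
    _ = α * (-(n * Real.log 2) - Real.log 16 - 1 / 2 * Real.log r) := by
        rw [integral_mul_const]
    _ ≤ α * Real.log α := mul_le_mul_of_nonneg_left hlog hα0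

lemma hasDerivAt_log_one_sub_log {x : ℝ} (hx : 0 < x) (hu : 0 < 1 - Real.log x) :
    HasDerivAt (fun y => Real.log (1 - Real.log y) + (1 - Real.log y)⁻¹)
      (logSqDensity x * Real.log x) x := by
  have h := (Real.hasDerivAt_log hx.ne').const_sub 1
  refine ((h.log hu.ne').add (h.inv hu.ne')).congr_deriv ?_
  unfold logSqDensity
  field_simp
  ring

lemma integrableOn_logSqDensity_mul_log {ε : ℝ} (hε : 0 < ε) :
    IntegrableOn (fun x => logSqDensity x * Real.log x) (Set.Ico ε 1) := by
  refine IntegrableOn.mono_set (ContinuousOn.integrableOn_Icc fun x hx => ?_)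
    Set.Ico_subset_Icc_self
  have hx0 : 0 < x := hε.trans_le hx.1
  have hu : 0 < 1 - Real.log x := by linarith [Real.log_nonpos hx0.le hx.2]
  have hl := Real.continuousAt_log hx0.ne'
  unfold logSqDensity
  refine ContinuousAt.continuousWithinAt (ContinuousAt.mul (ContinuousAt.div continuousAt_const
    (continuousAt_id.mul ((continuousAt_const.sub hl).pow 2)) ?_) hl)
  exact (mul_pos hx0 (pow_pos hu 2)).ne'

lemma setIntegral_logSqDensity_mul_log_le {ε : ℝ} (hε : 0 < ε) (hε1 : ε ≤ 1) :
    ∫ x in Set.Ico ε 1, logSqDensity x * Real.log x ≤ 1 - Real.log (1 - Real.log ε) := by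
  have hint := integrableOn_logSqDensity_mul_log hε
  have h := intervalIntegral.integral_eq_sub_of_hasDerivAt (a := ε) (b := 1)
    (f := fun y => Real.log (1 - Real.log y) + (1 - Real.log y)⁻¹)
    (f' := fun x => logSqDensity x * Real.log x)
    (fun x hx => by
      rw [Set.uIcc_of_le hε1] at hx
      have hx0 : 0 < x := hε.trans_le hx.1
      exact hasDerivAt_log_one_sub_log hx0 (by linarith [Real.log_nonpos hx0.le hx.2]))
    ((intervalIntegrable_iff_integrableOn_Ico_of_le hε1).2 hint)
  rw [intervalIntegral.integral_of_le hε1, integral_Ioc_eq_integral_Ioo] at h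
  rw [integral_Ico_eq_integral_Ioo, h]
  have hinv : 0 ≤ (1 - Real.log ε)⁻¹ :=
    inv_nonneg.2 (by linarith [Real.log_nonpos hε.le hε1])
  simp only [Real.log_one, sub_zero, inv_one]
  linarith

lemma setIntegral_logSqDensity_mul_log_add_le {ε : ℝ} (hε : 0 < ε) (hε1 : ε ≤ 1) :
    ∫ x in Set.Ico (0 : ℝ) 1, logSqDensity x * Real.log (x + ε) ≤
      Real.log 2 + 1 - Real.log (1 - Real.log ε) := by
  have hsub : Set.Ico ε 1 ⊆ Set.Ico (0 : ℝ) 1 := Set.Ico_subset_Ico_left hε.le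
  have hind : IntegrableOn ((Set.Ico ε 1).indicator fun x => logSqDensity x * Real.log x)
      (Set.Ico 0 1) :=
    ((integrable_indicator_iff measurableSet_Ico).2
      (integrableOn_logSqDensity_mul_log hε)).integrableOn
  have hc := integrableOn_logSqDensity.mul_const (Real.log 2)
  calc _ ≤ ∫ x in Set.Ico (0 : ℝ) 1, (logSqDensity x * Real.log 2 +
        (Set.Ico ε 1).indicator (fun x => logSqDensity x * Real.log x) x) := by
        refine setIntegral_mono_on (integrableOn_logSqDensity_mul_log_add hε) (hc.add hind)
          measurableSet_Ico fun x hx => ?_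
        have hf := logSqDensity_nonneg hx.1
        by_cases hxε : x ∈ Set.Ico ε 1
        · have hx0 : 0 < x := hε.trans_le hxε.1
          have hl : Real.log (x + ε) ≤ Real.log 2 + Real.log x := by
            rw [← Real.log_mul two_ne_zero hx0.ne']
            exact Real.log_le_log (by positivity) (by linarith [hxε.1])
          rw [Set.indicator_of_mem hxε, ← mul_add]
          exact mul_le_mul_of_nonneg_left hl hf
        · rw [Set.indicator_of_notMem hxε, add_zero]
          refine mul_le_mul_of_nonneg_left (Real.log_le_log ?_ ?_) hf <;>
            linarith [hx.1, hx.2]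
    _ = Real.log 2 + ∫ x in Set.Ico ε 1, logSqDensity x * Real.log x := by
        rw [integral_add hc hind, integral_mul_const, setIntegral_Ico_logSqDensity, one_mul,
          setIntegral_indicator measurableSet_Ico, Set.inter_eq_right.2 hsub]
    _ ≤ _ := by linarith [setIntegral_logSqDensity_mul_log_le hε hε1]

/-- An explicit lower bound for `∑ α_σ ln α_σ`. -/
lemma le_sum_mul_log (n : ℕ) :
    -(n * Real.log 2) - Real.log 16 -
        1 / 2 * (Real.log 2 + 1 - Real.log (1 + n * Real.log 2)) ≤
      ∑ σ : Fin n → Bool, (∫ x in dyadicInterval σ, logSqDensity x) *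
        Real.log (∫ x in dyadicInterval σ, logSqDensity x) := by
  have hpos : (0 : ℝ) < (2 : ℝ) ^ (-(n : ℤ)) := by positivity
  have hle : (2 : ℝ) ^ (-(n : ℤ)) ≤ 1 := zpow_le_one_of_nonpos₀ one_le_two (by simp)
  refine le_trans ?_ (Finset.sum_le_sum fun σ _ => le_setIntegral_mul_log σ)
  have hf := integrableOn_logSqDensity.const_mul (-(n * Real.log 2) - Real.log 16)
  have hfl := (integrableOn_logSqDensity_mul_log_add hpos).const_mul (1 / 2)
  rw [sum_setIntegral_dyadicInterval (g := fun x => _ - _) (hf.sub hfl),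
    integral_sub hf hfl, integral_const_mul, integral_const_mul, setIntegral_Ico_logSqDensity]
  have h := setIntegral_logSqDensity_mul_log_add_le hpos hle
  rw [Real.log_zpow] at h
  push_cast at h
  rw [show 1 - -(n : ℝ) * Real.log 2 = 1 + n * Real.log 2 by ring] at h
  linarith

/-- For `f(x) = 1/(x·(1 - ln x)²)` on `(0,1)` one has `∫₀¹ f = 1`,
and with `α_σ := ∫_[σ] f` and `H_n := -∑_{σ ∈ 2^n} α_σ·log₂ α_σ`, one has
`lim_n (H_n - n) = -∞`: for every natural number `c`, `H_n < n - c` for all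
sufficiently large `n`. -/
theorem entropy_defect_tendsto_atBot :
    (∫ x in Set.Ioo (0 : ℝ) 1, 1 / (x * (1 - Real.log x) ^ 2)) = 1 ∧
    Filter.Tendsto (fun n : ℕ =>
        (-∑ σ : Fin n → Bool,
            (∫ x in dyadicInterval σ, 1 / (x * (1 - Real.log x) ^ 2)) *
              Real.logb 2 (∫ x in dyadicInterval σ, 1 / (x * (1 - Real.log x) ^ 2))) -
          (n : ℝ))
      Filter.atTop Filter.atBot := by

  change (∫ x in Set.Ioo (0 : ℝ) 1, logSqDensity x) = 1 ∧
    Filter.Tendsto (fun n : ℕ =>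
        (-∑ σ : Fin n → Bool, (∫ x in dyadicInterval σ, logSqDensity x) *
              Real.logb 2 (∫ x in dyadicInterval σ, logSqDensity x)) - (n : ℝ))
      Filter.atTop Filter.atBot
  refine ⟨setIntegral_logSqDensity, ?_⟩
  have hlog2 : 0 < Real.log 2 := Real.log_pos one_lt_two
  have htop : Filter.Tendsto (fun n : ℕ => Real.log (1 + n * Real.log 2))
      Filter.atTop Filter.atTop :=
    Real.tendsto_log_atTop.comp (Filter.tendsto_atTop_add_const_left _ _
      (tendsto_natCast_atTop_atTop.atTop_mul_const hlog2))
  refine Filter.tendsto_atBot_mono (f := fun n : ℕ =>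
    (Real.log 16 + 1 / 2 * (Real.log 2 + 1) + -(1 / 2 * Real.log (1 + n * Real.log 2))) /
      Real.log 2) (fun n => ?_) ?_
  · have h := le_sum_mul_log n
    simp only [Real.logb, ← mul_div_assoc, ← Finset.sum_div]
    rw [le_div_iff₀ hlog2, sub_mul, neg_mul, div_mul_cancel₀ _ hlog2.ne']
    linarith
  · exact (Filter.tendsto_atBot_add_const_left _ _ (Filter.tendsto_neg_atTop_atBot.comp
      (htop.const_mul_atTop one_half_pos))).atBot_div_const hlog2
end
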